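/- arXiv:1108.4373 — 5 statements merged into one kernel-verified Lean document; each statement's English description precedes it below -/
import Mathlib

section
/- Let $n$ be a positive integer and let $\mathcal{F}$ be a $Q_2$-free family of subsets of $[n]=\{1,\dots,n\}$ such that there exist integers $i_1 < i_2 < i_3$ with every member of $\mathcal{F}$ having size in $\{i_1, i_2, i_3\}$ (i.e., $\mathcal{F}$ is contained in the union of three layers of $Q_n$). Then $|\mathcal{F}| \le \frac{3+2\sqrt{3}}{3}\binom{n}{\lfloor n/2\rfloor} + o\!\left(\binom{n}{\lfloor n/2\rfloor}\right)$; precisely: for every $\varepsilon > 0$ there exists $n_0$ such that for all $n \ge n_0$, every such family satisfies $|\mathcal{F}| \le \left(\frac{3+2\sqrt{3}}{3} + \varepsilon\right)\binom{n}{\lfloor n/2\rfloor}$. -/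
/-- A family of finite sets is `Q₂`-free if it does not contain four pairwise
distinct sets `A, B, C, D` with `A ⊆ B ⊆ D` and `A ⊆ C ⊆ D`. -/
def Q2Free {α : Type*} [DecidableEq α] (F : Finset (Finset α)) : Prop :=
  ¬ ∃ A B C D : Finset α, A ∈ F ∧ B ∈ F ∧ C ∈ F ∧ D ∈ F ∧
    A ≠ B ∧ A ≠ C ∧ A ≠ D ∧ B ≠ C ∧ B ≠ D ∧ C ≠ D ∧
    A ⊆ B ∧ B ⊆ D ∧ A ⊆ C ∧ C ⊆ D

section

open Finset FinsetFamily

section Counting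

variable {ι κ : Type*}

/-- If every edge at `y` leads to a point of degree at most `w y`, then weighting the edges at `y`
by `1 / w y` gives total weight at most one at each point on the other side. -/
lemma sum_card_div_le_card (s : Finset ι) (t : Finset κ) (r : ι → κ → Prop)
    [∀ x, DecidablePred (r x)] (w : κ → ℝ)
    (h : ∀ x ∈ s, ∀ y ∈ t, r x y → (#{y' ∈ t | r x y'} : ℝ) ≤ w y) :
    ∑ y ∈ t, (#{x ∈ s | r x y} : ℝ) / w y ≤ #s := by
  have key : ∀ x ∈ s, ∑ y ∈ t, (if r x y then 1 / w y else 0) ≤ (1 : ℝ) := by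
    intro x hx
    rw [← sum_filter]
    rcases eq_empty_or_nonempty {y ∈ t | r x y} with he | hne
    · simp [he]
    · have hpos : (0 : ℝ) < #{y ∈ t | r x y} := by exact_mod_cast hne.card_pos
      calc ∑ y ∈ t with r x y, 1 / w y
          ≤ ∑ y ∈ t with r x y, 1 / (#{y ∈ t | r x y} : ℝ) := by
            refine sum_le_sum fun y hy => ?_
            rw [mem_filter] at hy
            exact one_div_le_one_div_of_le hpos (h x hx y hy.1 hy.2)
        _ = 1 := by
            rw [sum_const, nsmul_eq_mul]
            field_simp
  calc ∑ y ∈ t, (#{x ∈ s | r x y} : ℝ) / w y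
      = ∑ y ∈ t, ∑ x ∈ s, (if r x y then 1 / w y else 0) := by
        refine sum_congr rfl fun y _ => ?_
        rw [← sum_filter, sum_const, nsmul_eq_mul]
        ring
    _ = ∑ x ∈ s, ∑ y ∈ t, (if r x y then 1 / w y else 0) := sum_comm
    _ ≤ ∑ x ∈ s, (1 : ℝ) := sum_le_sum key
    _ = #s := by simp

/-- Double counting of the edges between `s` and `t`, split according to a subset `b` of `t`. -/
lemma card_mul_le_sum_add (s : Finset ι) (t b : Finset κ) (r : ι → κ → Prop)
    [∀ x, DecidablePred (r x)] (hb : b ⊆ t) {p q : ℕ}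
    (hp : ∀ x ∈ s, p ≤ #{y ∈ t | r x y}) (hq : ∀ y ∈ t, #{x ∈ s | r x y} ≤ q) :
    (#s : ℝ) * p ≤ ∑ y ∈ b, (#{x ∈ s | r x y} : ℝ) + q * (#t - #b) := by
  classical
  have h1 : #s * p ≤ ∑ y ∈ t, #{x ∈ s | r x y} := by
    have := sum_card_bipartiteAbove_eq_sum_card_bipartiteBelow (s := s) (t := t) r
    simp only [bipartiteAbove, bipartiteBelow] at this
    rw [← this, ← smul_eq_mul]
    exact card_nsmul_le_sum _ _ _ hp
  have h2 : ∑ y ∈ t \ b, #{x ∈ s | r x y} ≤ #(t \ b) * q :=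
    sum_le_card_nsmul _ _ _ fun y hy => hq y (mem_sdiff.1 hy).1
  rw [← sum_sdiff hb] at h1
  have h3 : (#(t \ b) : ℝ) = #t - #b := by rw [cast_card_sdiff hb]
  have h4 : (#s : ℝ) * p ≤ #(t \ b) * q + ∑ y ∈ b, (#{x ∈ s | r x y} : ℝ) := by
    exact_mod_cast h1.trans (Nat.add_le_add_right h2 _)
  rw [h3] at h4
  linarith

end Counting

section Degrees

variable {α : Type*} [DecidableEq α] [Fintype α] {X Y Z : Finset α} {l : ℕ}

lemma le_card_supersets (hX : #X + 1 = l) (hl : l ≤ Fintype.card α) :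
    Fintype.card α - l + 1 ≤ #{Y ∈ powersetCard l (univ : Finset α) | X ⊆ Y} := by
  have : #(Xᶜ.image fun a => insert a X) = #Xᶜ := by
    refine card_image_of_injOn fun a ha b hb hab => ?_
    simp only [coe_compl, Set.mem_compl_iff, mem_coe] at ha hb
    exact (insert_inj ha).1 hab
  have h2 : #Xᶜ = Fintype.card α - l + 1 := by
    rw [card_compl]; omega
  rw [← h2, ← this]
  refine card_le_card fun Y hY => ?_
  obtain ⟨a, ha, rfl⟩ := mem_image.1 hY
  rw [mem_compl] at ha
  simp [mem_powersetCard, card_insert_of_notMem ha, hX]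

lemma le_card_subsets (hZ : #Z = l + 1) :
    l + 1 ≤ #{Y ∈ powersetCard l (univ : Finset α) | Y ⊆ Z} := by
  have : #(powersetCard l Z) = l + 1 := by
    rw [card_powersetCard, hZ, Nat.choose_succ_self_right]
  rw [← this]
  refine card_le_card fun Y hY => ?_
  rw [mem_powersetCard] at hY
  simp [mem_powersetCard, hY]

lemma exists_insert_of_subset (hYZ : Y ⊆ Z) (h : #Z = #Y + 1) : ∃ a ∈ Yᶜ, insert a Y = Z := by
  obtain ⟨a, ha, h1⟩ := covBy_iff_exists_insert.1 (covBy_iff_card_sdiff_eq_one.2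
    ⟨hYZ, by rw [card_sdiff_of_subset hYZ]; omega⟩)
  exact ⟨a, mem_compl.2 ha, h1⟩

lemma card_filter_superset_le {C : Finset (Finset α)} (hC : ∀ Z ∈ C, #Z = l + 1) (hY : #Y = l) :
    #{Z ∈ C | Y ⊆ Z} ≤ Fintype.card α - l := by
  calc #{Z ∈ C | Y ⊆ Z} ≤ #(Yᶜ.image fun a => insert a Y) := by
        refine card_le_card fun Z hZ => ?_
        rw [mem_filter] at hZ
        exact mem_image.2 (exists_insert_of_subset hZ.2 (by rw [hC Z hZ.1, hY]))
    _ ≤ Fintype.card α - l := card_image_le.trans (by rw [card_compl, hY])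

end Degrees

section Analytic

/-- The choice of `p` and `q` makes the discriminant in the symmetric case vanish. -/
lemma weighted_degree_inequality {d u : ℝ} (hd0 : 0 ≤ d) (hd1 : d < 1) (hu0 : 0 ≤ u)
    (hu1 : u < 1) :
    0 ≤ 2 * √3 / 3 - (1 / 2 + √3 / 3) * (d + u) +
      (√3 / 3 - 1 / 2) * (d / (1 - u) + u / (1 - d)) := by
  have hs2 : √3 ^ 2 = 3 := Real.sq_sqrt (by norm_num)
  have hs : 3 / 2 < √3 := Real.lt_sqrt_of_sq_lt (by norm_num)
  set s := √3
  have hd : 0 < 1 - d := by linarith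
  have hu : 0 < 1 - u := by linarith
  obtain ⟨v, hv⟩ : ∃ v, v = d + u := ⟨_, rfl⟩
  obtain ⟨m, hm⟩ : ∃ m, m = d * u := ⟨_, rfl⟩
  have hm0 : 0 ≤ m := hm ▸ mul_nonneg hd0 hu0
  have hm1 : v - 1 ≤ m := by rw [hv, hm]; nlinarith [mul_pos hd hu]
  have hm2 : m ≤ v ^ 2 / 4 := by rw [hv, hm]; nlinarith [sq_nonneg (d - u)]
  have hv2 : v < 2 := by linarith
  have hv0 : 0 ≤ v := by linarith
  have key : 0 ≤ (2 * s / 3 - (1 / 2 + s / 3) * v) * (1 - v + m) +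
      (s / 3 - 1 / 2) * (v - v ^ 2 + 2 * m) := by
    rcases le_total v 1 with h | h
    · have h1 : 0 ≤ 2 * s / 3 - (1 / 2 + s / 3) * v := by nlinarith
      have h2 : 0 ≤ v - v ^ 2 + 2 * m := by nlinarith
      exact add_nonneg (mul_nonneg h1 (by linarith)) (mul_nonneg (by linarith) h2)
    · have e1 : 0 ≤ (s / 3 - 1 / 2) * ((v - 1) * (2 - v)) :=
        mul_nonneg (by linarith) (mul_nonneg (by linarith) (by linarith))
      have e2 : 0 ≤ (1 - v / 2) * ((1 / 2 + s / 3) / 2 * (v - (2 * s - 2)) ^ 2) :=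
        mul_nonneg (by linarith) (mul_nonneg (by linarith) (sq_nonneg _))
      have e3 : (1 - v / 2) * ((1 / 2 + s / 3) / 2 * (v - (2 * s - 2)) ^ 2) =
          (2 * s / 3 - (1 / 2 + s / 3) * v) * (1 - v + v ^ 2 / 4) +
            (s / 3 - 1 / 2) * (v - v ^ 2 + 2 * (v ^ 2 / 4)) := by
        linear_combination (1 - v / 2) * (-(2/3) * v + (2 / 3) * s - 1 / 3) * hs2
      rcases le_total 0 (2 * s / 3 - (1 / 2 + s / 3) * v + 2 * (s / 3 - 1 / 2)) with hb | hb
      · nlinarith [mul_nonneg hb (sub_nonneg.2 hm1)]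
      · nlinarith [mul_nonneg (neg_nonneg.2 hb) (sub_nonneg.2 hm2)]
  have hrw : 2 * s / 3 - (1 / 2 + s / 3) * (d + u) +
      (s / 3 - 1 / 2) * (d / (1 - u) + u / (1 - d)) =
      ((2 * s / 3 - (1 / 2 + s / 3) * v) * (1 - v + m) +
      (s / 3 - 1 / 2) * (v - v ^ 2 + 2 * m)) / ((1 - d) * (1 - u)) := by
    rw [hv, hm]
    field_simp
    ring
  rw [hrw]
  exact div_nonneg key (mul_pos hd hu).le

/-- `weighted_degree_inequality` for degrees `D` and `U` out of `l` and `m`. -/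
lemma weighted_degree_inequality_of_le {l m D U : ℝ} (hlR : 0 < l) (hmR : 0 < m) (hD0 : 0 ≤ D)
    (hDl : D ≤ l) (hU0 : 0 ≤ U) (hUm : U ≤ m) :
    0 ≤ (2 * √3 / 3 + (1 / 2 + √3 / 3) * (1 / (l + 1) + 1 / (m + 1))) -
      (1 / 2 + √3 / 3) * (1 / l * D + 1 / m * U) +
      (√3 / 3 - 1 / 2) * ((m + 1) / l * (D / (m + 1 - U)) +
        (l + 1) / m * (U / (l + 1 - D))) := by
  have hs : 3 / 2 < √3 := Real.lt_sqrt_of_sq_lt (by norm_num)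
  have hdl : 1 / l * D ≤ D / (l + 1) + 1 / (l + 1) := by
    have : 1 / l * D = D / (l + 1) + D / l * (1 / (l + 1)) := by field_simp
    rw [this]
    gcongr
    exact mul_le_of_le_one_left (by positivity) ((div_le_one hlR).2 hDl)
  have hum : 1 / m * U ≤ U / (m + 1) + 1 / (m + 1) := by
    have : 1 / m * U = U / (m + 1) + U / m * (1 / (m + 1)) := by field_simp
    rw [this]
    gcongr
    exact mul_le_of_le_one_left (by positivity) ((div_le_one hmR).2 hUm)
  have h1 : 0 < l + 1 - D := by linarith
  have h2 : 0 < m + 1 - U := by linarith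
  have hd2 : D / (l + 1) / (1 - U / (m + 1)) ≤ (m + 1) / l * (D / (m + 1 - U)) := by
    have : D / (l + 1) / (1 - U / (m + 1)) =
        (m + 1) / (l + 1) * (D / (m + 1 - U)) := by
      field_simp
    rw [this]
    gcongr
    linarith
  have hu2 : U / (m + 1) / (1 - D / (l + 1)) ≤ (l + 1) / m * (U / (l + 1 - D)) := by
    have : U / (m + 1) / (1 - D / (l + 1)) =
        (l + 1) / (m + 1) * (U / (l + 1 - D)) := by
      field_simp
    rw [this]
    gcongr
    linarith
  have := weighted_degree_inequality (d := D / (l + 1)) (u := U / (m + 1)) (by positivity)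
    ((div_lt_one (by positivity)).2 (by linarith)) (by positivity)
    ((div_lt_one (by positivity)).2 (by linarith))
  have e1 := mul_le_mul_of_nonneg_left (add_le_add hdl hum)
    (by linarith : 0 ≤ 1 / 2 + √3 / 3)
  have e2 := mul_le_mul_of_nonneg_left (add_le_add hd2 hu2)
    (by linarith : 0 ≤ √3 / 3 - 1 / 2)
  linarith

lemma div_density_mul_eq {N l m : ℝ} (a : ℝ) (hN : 0 < N) (hl : 0 < l) (hm : 0 < m) :
    a / (N * l / (m + 1)) * N = (m + 1) / l * a := by
  field_simp

lemma exists_choose_le_mul_choose_half (ε : ℝ) (hε : 0 < ε) (L : ℕ) :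
    ∃ n0 : ℕ, ∀ n l : ℕ, n0 ≤ n → l < L ∨ n < L + l →
      (n.choose l : ℝ) ≤ ε * n.choose (n / 2) := by
  obtain ⟨k, hk⟩ := exists_nat_ge (L / ε)
  refine ⟨L + k, fun n l hn hl => ?_⟩
  rcases lt_or_ge n l with hnl | hnl
  · rw [Nat.choose_eq_zero_of_lt hnl]
    simp only [Nat.cast_zero]
    positivity
  have main : ∀ j, j < L → j ≤ n → (n.choose j : ℝ) ≤ ε * n.choose (n / 2) := by
    intro j hj hjn
    have h1 : (n.choose j : ℝ) * (n - j : ℕ) = n.choose (j + 1) * (j + 1 : ℕ) := by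
      exact_mod_cast (Nat.choose_succ_right_eq n j).symm
    have h2 : (n.choose (j + 1) : ℝ) ≤ n.choose (n / 2) := by
      exact_mod_cast Nat.choose_le_middle _ _
    have h3 : ((j + 1 : ℕ) : ℝ) ≤ L := by exact_mod_cast hj
    have h4 : (k : ℝ) + 1 ≤ (n - j : ℕ) := by
      exact_mod_cast (by omega : k + 1 ≤ n - j)
    have h5 : (L : ℝ) ≤ ε * k := by
      rw [div_le_iff₀ hε] at hk
      linarith
    have h6 : (n.choose j : ℝ) * (k + 1) ≤ n.choose (n / 2) * (ε * (k + 1)) := by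
      calc (n.choose j : ℝ) * (k + 1) ≤ n.choose j * (n - j : ℕ) := by gcongr
        _ = n.choose (j + 1) * (j + 1 : ℕ) := h1
        _ ≤ n.choose (n / 2) * L := by gcongr
        _ ≤ n.choose (n / 2) * (ε * (k + 1)) := by
          gcongr
          linarith
    have h7 : (0 : ℝ) < k + 1 := by positivity
    refine le_of_mul_le_mul_right ?_ h7
    linarith
  rcases hl with hl | hl
  · exact main l hl hnl
  · rw [← Nat.choose_symm hnl]
    exact main _ (by omega) (Nat.sub_le _ _)

end Analytic

section Shadow

variable {α : Type*} [DecidableEq α] [Fintype α] {r : ℕ}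

lemma card_div_choose_le_card_shadow_iterate {C : Finset (Finset α)} (k : ℕ)
    (hC : (C : Set (Finset α)).Sized (r + k)) :
    (#C : ℝ) / (Fintype.card α).choose (r + k) ≤
      #(∂^[k] C) / (Fintype.card α).choose r := by
  induction k generalizing C with
  | zero => simp
  | succ k ih =>
    rw [Function.iterate_succ_apply]
    exact (local_lubell_yamamoto_meshalkin_inequality_div (by omega) hC).trans
      (ih (by simpa using hC.shadow))

lemma sized_compls {A : Finset (Finset α)} (hA : (A : Set (Finset α)).Sized r) :
    (Aᶜˢ : Set (Finset α)).Sized (Fintype.card α - r) := by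
  intro X hX
  rw [mem_coe, mem_compls] at hX
  have := hA (mem_coe.2 hX)
  rw [card_compl] at this
  have := card_le_univ X
  omega

lemma exists_shadow_family {C : Finset (Finset α)} {m : ℕ} (hr : r ≤ m)
    (hC : (C : Set (Finset α)).Sized m) :
    ∃ C' : Finset (Finset α), (∀ Z ∈ C', #Z = r) ∧ (∀ Z ∈ C', ∃ W ∈ C, Z ⊆ W) ∧
      (#C : ℝ) / (Fintype.card α).choose m ≤ #C' / (Fintype.card α).choose r := by
  obtain ⟨k, rfl⟩ := Nat.exists_eq_add_of_le hr
  refine ⟨∂^[k] C, ?_, ?_, card_div_choose_le_card_shadow_iterate k hC⟩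
  · intro Z hZ
    simpa using hC.shadow_iterate hZ
  · intro Z hZ
    obtain ⟨W, hW, h, -⟩ := mem_shadow_iterate_iff_exists_mem_card_add.1 hZ
    exact ⟨W, hW, h⟩

lemma exists_upShadow_family {A : Finset (Finset α)} {k : ℕ} (hk : k ≤ r)
    (hr : r ≤ Fintype.card α) (hA : (A : Set (Finset α)).Sized k) :
    ∃ A' : Finset (Finset α), (∀ X ∈ A', #X = r) ∧ (∀ X ∈ A', ∃ W ∈ A, W ⊆ X) ∧
      (#A : ℝ) / (Fintype.card α).choose k ≤ #A' / (Fintype.card α).choose r := by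
  obtain ⟨A', h1, h2, h3⟩ := exists_shadow_family
    (Nat.sub_le_sub_left hk (Fintype.card α)) (sized_compls hA)
  refine ⟨A'ᶜˢ, ?_, ?_, ?_⟩
  · intro X hX
    have := h1 _ (mem_compls.1 hX)
    rw [card_compl] at this
    have := card_le_univ X
    omega
  · intro X hX
    obtain ⟨W, hW, hXW⟩ := h2 _ (mem_compls.1 hX)
    exact ⟨Wᶜ, mem_compls.1 hW, compl_le_iff_compl_le.1 hXW⟩
  · rwa [card_compls, Nat.choose_symm (hk.trans hr), Nat.choose_symm hr, ← card_compls A'] at h3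

end Shadow

section ConsecutiveLayers

variable {α : Type*} [DecidableEq α] {A B C : Finset (Finset α)} {X Y Z : Finset α} {l : ℕ}

lemma card_filter_subset_le (hA : ∀ X ∈ A, #X + 1 = l) (hY : #Y = l) :
    #{X ∈ A | X ⊆ Y} ≤ l := by
  rcases l with - | l
  · simp [filter_eq_empty_iff.2 fun X hX => absurd (hA X hX) (Nat.succ_ne_zero _)]
  calc #{X ∈ A | X ⊆ Y} ≤ #(powersetCard l Y) := by
        refine card_le_card fun X hX => ?_
        rw [mem_filter] at hX
        exact mem_powersetCard.2 ⟨hX.2, Nat.succ_injective (hA X hX.1)⟩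
    _ = l + 1 := by rw [card_powersetCard, hY, Nat.choose_succ_self_right]

lemma card_superset_add_card_superset_le [Fintype α] (hB : ∀ Y ∈ B, #Y = l)
    (hC : ∀ Z ∈ C, #Z = l + 1) (hX : #X + 1 = l)
    (H : ∀ Z ∈ C, ∀ Y ∈ B, ∀ Y' ∈ B, X ⊆ Y → X ⊆ Y' → Y ⊆ Z → Y' ⊆ Z → Y = Y')
    (hY : Y ∈ B) (hXY : X ⊆ Y) :
    #{Y' ∈ B | X ⊆ Y'} + #{Z ∈ C | Y ⊆ Z} ≤ Fintype.card α - l + 1 := by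
  have h1 : #{Y' ∈ B | X ⊆ Y'} ≤ #{a ∈ Xᶜ | insert a X ∈ B} := by
    refine (card_le_card fun Y' hY' => ?_).trans (card_image_le (f := fun a => insert a X))
    rw [mem_filter] at hY'
    obtain ⟨a, ha, rfl⟩ := exists_insert_of_subset hY'.2 (by rw [hB _ hY'.1, hX])
    exact mem_image.2 ⟨a, mem_filter.2 ⟨ha, hY'.1⟩, rfl⟩
  have h2 : #{Z ∈ C | Y ⊆ Z} ≤ #{a ∈ Yᶜ | insert a Y ∈ C} := by
    refine (card_le_card fun Z hZ => ?_).trans (card_image_le (f := fun a => insert a Y))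
    rw [mem_filter] at hZ
    obtain ⟨a, ha, rfl⟩ := exists_insert_of_subset hZ.2 (by rw [hC _ hZ.1, hB Y hY])
    exact mem_image.2 ⟨a, mem_filter.2 ⟨ha, hZ.1⟩, rfl⟩
  have hdisj : Disjoint {a ∈ Xᶜ | insert a X ∈ B} {a ∈ Yᶜ | insert a Y ∈ C} := by
    refine disjoint_left.2 fun a ha ha' => ?_
    rw [mem_filter] at ha ha'
    have := H _ ha'.2 _ hY _ ha.2 hXY (subset_insert a X) (subset_insert a Y)
      (insert_subset_insert a hXY)
    exact mem_compl.1 ha'.1 (this ▸ mem_insert_self a X)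
  have h3 : #Xᶜ ≤ Fintype.card α - l + 1 := by
    rw [card_compl]; omega
  refine (Nat.add_le_add h1 h2).trans ?_
  rw [← card_union_of_disjoint hdisj]
  exact (card_le_card (union_subset (filter_subset _ _)
    ((filter_subset _ _).trans (compl_subset_compl.2 hXY)))).trans h3

lemma card_subset_add_card_subset_le (hA : ∀ X ∈ A, #X + 1 = l) (hB : ∀ Y ∈ B, #Y = l)
    (hZ : #Z = l + 1)
    (H : ∀ X ∈ A, ∀ Y ∈ B, ∀ Y' ∈ B, X ⊆ Y → X ⊆ Y' → Y ⊆ Z → Y' ⊆ Z → Y = Y')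
    (hY : Y ∈ B) (hYZ : Y ⊆ Z) :
    #{Y' ∈ B | Y' ⊆ Z} + #{X ∈ A | X ⊆ Y} ≤ l + 1 := by
  have exists_erase : ∀ {S T : Finset α}, S ⊆ T → #T = #S + 1 → ∃ a ∈ T, T.erase a = S := by
    intro S T hST h
    obtain ⟨a, ha⟩ := card_eq_one.1 (by rw [card_sdiff_of_subset hST]; omega : #(T \ S) = 1)
    have haT : a ∈ T \ S := ha ▸ mem_singleton_self a
    refine ⟨a, (mem_sdiff.1 haT).1, ?_⟩
    rw [erase_eq, ← ha, Finset.sdiff_sdiff_eq_self hST]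
  have h1 : #{Y' ∈ B | Y' ⊆ Z} ≤ #{a ∈ Z | Z.erase a ∈ B} := by
    refine (card_le_card fun Y' hY' => ?_).trans (card_image_le (f := fun a => Z.erase a))
    rw [mem_filter] at hY'
    obtain ⟨a, ha, rfl⟩ := exists_erase hY'.2 (by rw [hB _ hY'.1, hZ])
    exact mem_image.2 ⟨a, mem_filter.2 ⟨ha, hY'.1⟩, rfl⟩
  have h2 : #{X ∈ A | X ⊆ Y} ≤ #{a ∈ Y | Y.erase a ∈ A} := by
    refine (card_le_card fun X hX => ?_).trans (card_image_le (f := fun a => Y.erase a))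
    rw [mem_filter] at hX
    obtain ⟨a, ha, rfl⟩ := exists_erase hX.2 (by rw [hA _ hX.1, hB Y hY])
    exact mem_image.2 ⟨a, mem_filter.2 ⟨ha, hX.1⟩, rfl⟩
  have hdisj : Disjoint {a ∈ Z | Z.erase a ∈ B} {a ∈ Y | Y.erase a ∈ A} := by
    refine disjoint_left.2 fun a ha ha' => ?_
    rw [mem_filter] at ha ha'
    have := H _ ha'.2 _ hY _ ha.2 (erase_subset a Y) (erase_subset_erase a hYZ) hYZ
      (erase_subset a Z)
    exact notMem_erase a Z (this ▸ ha'.1)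
  refine (Nat.add_le_add h1 h2).trans ?_
  rw [← card_union_of_disjoint hdisj, ← hZ]
  exact card_le_card (union_subset (filter_subset _ _) ((filter_subset _ _).trans hYZ))

/-- The main estimate: three consecutive layers, with sizes measured relative to the layers. -/
lemma density_le_of_consecutive_layers [Fintype α] {m : ℕ} (hn : Fintype.card α = l + m)
    (hl : 0 < l) (hm : 0 < m) (hA : ∀ X ∈ A, #X + 1 = l) (hB : ∀ Y ∈ B, #Y = l)
    (hC : ∀ Z ∈ C, #Z = l + 1)
    (H : ∀ X ∈ A, ∀ Z ∈ C, ∀ Y ∈ B, ∀ Y' ∈ B,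
      X ⊆ Y → X ⊆ Y' → Y ⊆ Z → Y' ⊆ Z → Y = Y') :
    (#A : ℝ) / (l + m).choose (l - 1) + #B / (l + m).choose l + #C / (l + m).choose (l + 1) ≤
      1 + 2 * √3 / 3 + (1 / 2 + √3 / 3) * (1 / (l + 1) + 1 / (m + 1)) := by
  have hs : 3 / 2 < √3 := Real.lt_sqrt_of_sq_lt (by norm_num)
  have hlR : (0 : ℝ) < l := by exact_mod_cast hl
  have hmR : (0 : ℝ) < m := by exact_mod_cast hm
  have hml : Fintype.card α - l = m := by omega
  obtain ⟨N, hN⟩ : ∃ N : ℝ, N = (l + m).choose l := ⟨_, rfl⟩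
  have hNpos : 0 < N := by
    rw [hN]; exact_mod_cast Nat.choose_pos (Nat.le_add_right l m)
  have hNA : ((l + m).choose (l - 1) : ℝ) = N * l / (m + 1) := by
    rw [eq_div_iff (by positivity), hN]
    have := Nat.choose_succ_right_eq (l + m) (l - 1)
    rw [show l - 1 + 1 = l by omega, show l + m - (l - 1) = m + 1 by omega] at this
    exact_mod_cast this.symm
  have hNC : ((l + m).choose (l + 1) : ℝ) = N * m / (l + 1) := by
    rw [eq_div_iff (by positivity), hN]
    have := Nat.choose_succ_right_eq (l + m) l
    rw [show l + m - l = m by omega] at this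
    exact_mod_cast this
  obtain ⟨D, hD⟩ : ∃ D : Finset α → ℝ, ∀ Y, D Y = #{X ∈ A | X ⊆ Y} := ⟨_, fun _ => rfl⟩
  obtain ⟨U, hU⟩ : ∃ U : Finset α → ℝ, ∀ Y, U Y = #{Z ∈ C | Y ⊆ Z} := ⟨_, fun _ => rfl⟩
  have hBsub : B ⊆ powersetCard l univ := fun Y hY => mem_powersetCard.2 ⟨subset_univ _, hB Y hY⟩
  have hcard : (#(powersetCard l (univ : Finset α)) : ℝ) = N := by
    rw [card_powersetCard, card_univ, hn, hN]
  have hA1 : (#A : ℝ) * (m + 1) ≤ ∑ Y ∈ B, D Y + l * (N - #B) := by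
    have := card_mul_le_sum_add A (powersetCard l univ) B (fun X Y => X ⊆ Y) hBsub (p := m + 1)
      (q := l) (fun X hX => hml ▸ le_card_supersets (hA X hX) (by omega))
      (fun Y hY => card_filter_subset_le hA (mem_powersetCard.1 hY).2)
    simp only [hcard, ← hD] at this
    exact_mod_cast this
  have hC1 : (#C : ℝ) * (l + 1) ≤ ∑ Y ∈ B, U Y + m * (N - #B) := by
    have := card_mul_le_sum_add C (powersetCard l univ) B (fun Z Y => Y ⊆ Z) hBsub (p := l + 1)
      (q := m) (fun Z hZ => le_card_subsets (hC Z hZ))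
      (fun Y hY => hml ▸ card_filter_superset_le hC (mem_powersetCard.1 hY).2)
    simp only [hcard, ← hU] at this
    exact_mod_cast this
  have hA2 : ∑ Y ∈ B, D Y / (m + 1 - U Y) ≤ #A := by
    simp only [hD]
    refine sum_card_div_le_card A B (fun X Y => X ⊆ Y) _ fun X hX Y hY hXY => ?_
    have := card_superset_add_card_superset_le hB hC (hA X hX) (H X hX) hY hXY
    rw [hml] at this
    rw [le_sub_iff_add_le, hU]
    exact_mod_cast this
  have hC2 : ∑ Y ∈ B, U Y / (l + 1 - D Y) ≤ #C := by
    simp only [hU]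
    refine sum_card_div_le_card C B (fun Z Y => Y ⊆ Z) _ fun Z hZ Y hY hYZ => ?_
    have := card_subset_add_card_subset_le hA hB (hC Z hZ) (fun X hX => H X hX Z hZ) hY hYZ
    rw [le_sub_iff_add_le, hD]
    exact_mod_cast this
  have hpt : ∀ Y ∈ B, 0 ≤ (2 * √3 / 3 + (1 / 2 + √3 / 3) * (1 / (l + 1) + 1 / (m + 1))) -
      (1 / 2 + √3 / 3) * (1 / l * D Y + 1 / m * U Y) +
      (√3 / 3 - 1 / 2) * ((m + 1) / l * (D Y / (m + 1 - U Y)) +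
        (l + 1) / m * (U Y / (l + 1 - D Y))) := by
    intro Y hY
    have hD0 : 0 ≤ D Y := by simp [hD]
    have hU0 : 0 ≤ U Y := by simp [hU]
    have hDl : D Y ≤ l := by
      rw [hD]
      exact_mod_cast card_filter_subset_le hA (hB Y hY)
    have hUm : U Y ≤ m := by
      have := card_filter_superset_le hC (hB Y hY)
      rw [hml] at this
      rw [hU]
      exact_mod_cast this
    exact weighted_degree_inequality_of_le hlR hmR hD0 hDl hU0 hUm
  have hsum := sum_nonneg hpt
  simp only [sum_add_distrib, sum_sub_distrib, ← mul_sum, sum_const, nsmul_eq_mul] at hsum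
  have hA3 : (#A : ℝ) / (N * l / (m + 1)) * N ≤ 1 / l * ∑ Y ∈ B, D Y + (N - #B) := by
    rw [div_density_mul_eq _ hNpos hlR hmR, div_mul_eq_mul_div, div_le_iff₀ hlR, mul_comm]
    refine hA1.trans_eq ?_
    field_simp
  have hC3 : (#C : ℝ) / (N * m / (l + 1)) * N ≤ 1 / m * ∑ Y ∈ B, U Y + (N - #B) := by
    rw [div_density_mul_eq _ hNpos hmR hlR, div_mul_eq_mul_div, div_le_iff₀ hmR, mul_comm]
    refine hC1.trans_eq ?_
    field_simp
  have hA4 : (m + 1) / l * ∑ Y ∈ B, D Y / (m + 1 - U Y) ≤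
      (#A : ℝ) / (N * l / (m + 1)) * N := by
    rw [div_density_mul_eq _ hNpos hlR hmR]
    gcongr
  have hC4 : (l + 1) / m * ∑ Y ∈ B, U Y / (l + 1 - D Y) ≤
      (#C : ℝ) / (N * m / (l + 1)) * N := by
    rw [div_density_mul_eq _ hNpos hmR hlR]
    gcongr
  have hBN : (#B : ℝ) ≤ N := by
    rw [← hcard]; exact_mod_cast card_le_card hBsub
  rw [hNA, hNC, ← hN]
  set a := (#A : ℝ) / (N * l / (m + 1))
  set c := (#C : ℝ) / (N * m / (l + 1))
  set δ : ℝ := 1 / (l + 1) + 1 / (m + 1) with hδ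
  have hδ0 : 0 ≤ δ := by positivity
  have f1 := mul_le_mul_of_nonneg_left (add_le_add hA3 hC3) (by linarith : 0 ≤ 1 / 2 + √3 / 3)
  have f2 := mul_le_mul_of_nonneg_left (add_le_add hA4 hC4) (by linarith : 0 ≤ √3 / 3 - 1 / 2)
  have f3 := mul_le_mul_of_nonneg_left hBN
    (mul_nonneg (by linarith) hδ0 : 0 ≤ (1 / 2 + √3 / 3) * δ)
  refine le_of_mul_le_mul_right ?_ hNpos
  have : (a + #B / N + c) * N = a * N + #B + c * N := by field_simp
  rw [this]
  linarith

end ConsecutiveLayers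

section ThreeLayers

lemma Q2Free.eq_of_between {α : Type*} [DecidableEq α] {F : Finset (Finset α)} (hF : Q2Free F)
    {W Y Y' V : Finset α} (hW : W ∈ F) (hY : Y ∈ F) (hY' : Y' ∈ F) (hV : V ∈ F)
    (h1 : #W < #Y) (h2 : #W < #Y') (h3 : #Y < #V) (h4 : #Y' < #V)
    (hWY : W ⊆ Y) (hWY' : W ⊆ Y') (hYV : Y ⊆ V) (hYV' : Y' ⊆ V) : Y = Y' := by
  by_contra hne
  exact hF ⟨W, Y, Y', V, hW, hY, hY', hV, by grind, by grind, by grind, hne, by grind, by grind,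
    hWY, hYV, hWY', hYV'⟩

lemma card_le_density_mul_choose_half {n i : ℕ} {A : Finset (Finset (Fin n))}
    (hA : (A : Set (Finset (Fin n))).Sized i) :
    (#A : ℝ) ≤ #A / n.choose i * n.choose (n / 2) := by
  have hcard : #A ≤ n.choose i := by simpa using hA.card_le
  have hmid : (n.choose i : ℝ) ≤ n.choose (n / 2) := by exact_mod_cast Nat.choose_le_middle _ _
  rcases Nat.eq_zero_or_pos (n.choose i) with h0 | h0
  · simp [Nat.le_zero.1 (h0 ▸ hcard)]
  · have : (0 : ℝ) < n.choose i := by exact_mod_cast h0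
    rw [div_mul_eq_mul_div, le_div_iff₀ this]
    gcongr

lemma density_le_of_three_layers {α : Type*} [DecidableEq α] [Fintype α] {l m i j : ℕ}
    {A B C : Finset (Finset α)} (hn : Fintype.card α = l + m) (hl : 0 < l) (hm : 0 < m)
    (hi : i < l) (hj : l < j) (hA : (A : Set (Finset α)).Sized i)
    (hB : (B : Set (Finset α)).Sized l) (hC : (C : Set (Finset α)).Sized j)
    (H : ∀ X ∈ A, ∀ Z ∈ C, ∀ Y ∈ B, ∀ Y' ∈ B,
      X ⊆ Y → X ⊆ Y' → Y ⊆ Z → Y' ⊆ Z → Y = Y') :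
    (#A : ℝ) / (l + m).choose i + #B / (l + m).choose l + #C / (l + m).choose j ≤
      1 + 2 * √3 / 3 + (1 / 2 + √3 / 3) * (1 / (l + 1) + 1 / (m + 1)) := by
  obtain ⟨A', hA', hAA', hdA⟩ := exists_upShadow_family (r := l - 1) (by omega) (by omega) hA
  obtain ⟨C', hC', hCC', hdC⟩ := exists_shadow_family (r := l + 1) (by omega) hC
  rw [hn] at hdA hdC
  have := density_le_of_consecutive_layers (A := A') (B := B) (C := C') hn hl hm
    (fun X hX => by rw [hA' X hX]; omega) (fun Y hY => hB hY) hC' <| by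
      intro X hX Z hZ Y hY Y' hY' h1 h2 h3 h4
      obtain ⟨W, hW, hWX⟩ := hAA' X hX
      obtain ⟨V, hV, hZV⟩ := hCC' Z hZ
      exact H W hW V hV Y hY Y' hY' (hWX.trans h1) (hWX.trans h2) (h3.trans hZV) (h4.trans hZV)
  linarith

end ThreeLayers

end

theorem three_sizes_Q2_free_bound :
    ∀ ε : ℝ, 0 < ε → ∃ n0 : ℕ, ∀ n : ℕ, n0 ≤ n → 0 < n →
      ∀ (F : Finset (Finset (Fin n))),
        (∃ i1 i2 i3 : ℕ, i1 < i2 ∧ i2 < i3 ∧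
          ∀ A ∈ F, A.card = i1 ∨ A.card = i2 ∨ A.card = i3) →
        Q2Free F →
        (F.card : ℝ) ≤
          ((3 + 2 * Real.sqrt 3) / 3 + ε) * (n.choose (n / 2)) := by
  intro ε hε
  obtain ⟨L, hL⟩ := exists_nat_ge (4 / ε)
  have hLpos : 0 < (L : ℝ) := (div_pos (by norm_num) hε).trans_le hL
  obtain ⟨n0, hn0⟩ := exists_choose_le_mul_choose_half ε hε L
  refine ⟨n0, fun n hn _ F ⟨i, l, j, hil, hlj, hsize⟩ hF => ?_⟩
  have hs : 3 / 2 < √3 := Real.lt_sqrt_of_sq_lt (by norm_num)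
  have hs2 : √3 ≤ 2 := Real.sqrt_le_iff.2 (by norm_num)
  let layer : ℕ → Finset (Finset (Fin n)) := fun k => F.filter fun S => S.card = k
  have hlayer : ∀ k, (layer k : Set (Finset (Fin n))).Sized k := fun k S hS =>
    (Finset.mem_filter.1 (Finset.mem_coe.1 hS)).2
  have hsub : ∀ {k S}, S ∈ layer k → S ∈ F := fun hS => (Finset.mem_filter.1 hS).1
  have hFcard : (F.card : ℝ) ≤ (layer i).card + (layer l).card + (layer j).card := by
    have h1 : F ⊆ layer i ∪ layer l ∪ layer j := fun S hS => by
      simp only [layer, Finset.mem_union, Finset.mem_filter, hS, true_and, or_assoc]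
      exact hsize S hS
    have h2 := (Finset.card_le_card h1).trans ((Finset.card_union_le _ _).trans
      (Nat.add_le_add_right (Finset.card_union_le _ _) _))
    exact_mod_cast h2
  have hchoose : ∀ k, ((layer k).card : ℝ) ≤ n.choose k := fun k => by
    exact_mod_cast (by simpa using (hlayer k).card_le : (layer k).card ≤ n.choose k)
  have hmid : ∀ k, (n.choose k : ℝ) ≤ n.choose (n / 2) := fun k => by
    exact_mod_cast Nat.choose_le_middle _ _
  have hN : (0 : ℝ) ≤ n.choose (n / 2) := Nat.cast_nonneg _
  by_cases hl : l < L ∨ n < L + l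
  · have h1 := hn0 n l hn hl
    have h2 := (hchoose i).trans (hmid i)
    have h3 := (hchoose j).trans (hmid j)
    nlinarith [hchoose l, mul_nonneg (by linarith : 0 ≤ 2 * √3 / 3 - 1) hN]
  · push Not at hl
    obtain ⟨m, rfl⟩ := Nat.exists_eq_add_of_le ((Nat.le_add_left l L).trans hl.2)
    have hLm : L ≤ m := by omega
    have hL0 : 0 < L := by exact_mod_cast hLpos
    have hdens := density_le_of_three_layers (by simp) (hL0.trans_le hl.1) (hL0.trans_le hLm) hil
      hlj (hlayer i) (hlayer l) (hlayer j) fun X hX Z hZ Y hY Y' hY' =>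
        hF.eq_of_between (hsub hX) (hsub hY) (hsub hY') (hsub hZ)
          (by rwa [hlayer i hX, hlayer l hY]) (by rwa [hlayer i hX, hlayer l hY'])
          (by rwa [hlayer l hY, hlayer j hZ]) (by rwa [hlayer l hY', hlayer j hZ])
    have hsmall : ∀ k : ℕ, L ≤ k → 1 / ((k : ℝ) + 1) ≤ ε / 4 := fun k hk => by
      have hkL : (L : ℝ) ≤ k := by exact_mod_cast hk
      rw [div_le_iff₀ (by positivity)]
      rw [div_le_iff₀ hε] at hL
      nlinarith
    have herr : (1 / 2 + √3 / 3) * (1 / ((l : ℝ) + 1) + 1 / ((m : ℝ) + 1)) ≤ 2 * (ε / 4 + ε / 4) :=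
      mul_le_mul (by linarith) (add_le_add (hsmall l hl.1) (hsmall m hLm)) (by positivity)
        (by norm_num)
    refine hFcard.trans ((add_le_add (add_le_add (card_le_density_mul_choose_half (hlayer i))
      (card_le_density_mul_choose_half (hlayer l)))
      (card_le_density_mul_choose_half (hlayer j))).trans ?_)
    rw [← add_mul, ← add_mul]
    exact mul_le_mul_of_nonneg_right (by linarith) hN
end

section
/- Let $n$ and $k$ be positive integers with $1 \le k \le n-1$. Let $\mathcal{S} \subseteq \binom{[n]}{k-1}$, $\mathcal{T} \subseteq \binom{[n]}{k}$, $\mathcal{U} \subseteq \binom{[n]}{k+1}$, and suppose $\mathcal{F} = \mathcal{S} \cup \mathcal{T} \cup \mathcal{U}$ is $Q_2$-free. Then for any $X \in \mathcal{S}$ and $Y \in \mathcal{T}$ with $X \subseteq Y$, we have $f(X) + \breve{g}(Y) \le n - k + 1$, where $f(X) = |\{T \in \mathcal{T} : X \subseteq T\}|$ and $\breve{g}(Y) = |\{U \in \mathcal{U} : Y \subseteq U\}|$. -/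
/-- Removing a fixed common subset is injective on the sets containing it. -/
theorem card_image_sdiff_of_subset {α : Type*} [DecidableEq α] (F : Finset (Finset α))
    (X : Finset α) :
    ((F.filter (fun A => X ⊆ A)).image (fun A => A \ X)).card =
      (F.filter (fun A => X ⊆ A)).card := by
  refine Finset.card_image_of_injOn fun A hA B hB h => ?_
  simp only [Finset.coe_filter, Set.mem_ofPred_eq] at hA hB
  rw [← Finset.sdiff_union_of_subset hA.2, ← Finset.sdiff_union_of_subset hB.2]
  exact congrArg (· ∪ X) h

theorem f_plus_g_breve_le (n k : ℕ) (hk1 : 1 ≤ k) (hkn : k ≤ n - 1)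
    (S T U : Finset (Finset (Fin n)))
    (hS : ∀ A ∈ S, A.card = k - 1)
    (hT : ∀ A ∈ T, A.card = k)
    (hU : ∀ A ∈ U, A.card = k + 1)
    (hfree : Q2Free (S ∪ T ∪ U)) :
    ∀ X ∈ S, ∀ Y ∈ T, X ⊆ Y →
      (T.filter (fun T' => X ⊆ T')).card +
        (U.filter (fun U' => Y ⊆ U')).card ≤ n - k + 1 := by
  intro X hX Y hY hXY
  have hXc := hS X hX
  have hYc := hT Y hY
  have hdisj : Disjoint ((T.filter (fun A => X ⊆ A)).image (fun A => A \ X))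
      ((U.filter (fun A => Y ⊆ A)).image (fun A => A \ Y)) := by
    rw [Finset.disjoint_left]
    intro P hP hQ
    obtain ⟨A, hA, rfl⟩ := Finset.mem_image.1 hP
    obtain ⟨B, hB, hBA⟩ := Finset.mem_image.1 hQ
    obtain ⟨hAT, hXA⟩ := Finset.mem_filter.1 hA
    obtain ⟨hBU, hYB⟩ := Finset.mem_filter.1 hB
    have hAc := hT A hAT
    have hBc := hU B hBU
    have hAB : A ⊆ B := by
      rw [← Finset.sdiff_union_of_subset hXA, ← hBA]
      exact Finset.union_subset Finset.sdiff_subset (hXY.trans hYB)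
    have hYA : Y ≠ A := by
      rintro rfl
      have hempty : Y \ X = ∅ := by
        rw [← Finset.disjoint_self_iff_empty]
        nth_rewrite 1 [← hBA]
        exact Finset.sdiff_disjoint.mono_right Finset.sdiff_subset
      have := Finset.card_le_card (Finset.sdiff_eq_empty_iff_subset.1 hempty)
      omega
    refine hfree ⟨X, Y, A, B, by simp [hX], by simp [hY], by simp [hAT], by simp [hBU],
      ?_, ?_, ?_, hYA, ?_, ?_, hXY, hYB, hXA, hAB⟩ <;>
    · intro h
      have := congrArg Finset.card h
      omega
  have hsub : ((T.filter (fun A => X ⊆ A)).image (fun A => A \ X)) ∪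
      ((U.filter (fun A => Y ⊆ A)).image (fun A => A \ Y)) ⊆ Finset.powersetCard 1 Xᶜ := by
    intro P hP
    rw [Finset.mem_powersetCard]
    rcases Finset.mem_union.1 hP with hP | hP
    · obtain ⟨A, hA, rfl⟩ := Finset.mem_image.1 hP
      obtain ⟨hAT, hXA⟩ := Finset.mem_filter.1 hA
      refine ⟨fun a ha => by simp_all, ?_⟩
      rw [Finset.card_sdiff_of_subset hXA, hT A hAT]
      omega
    · obtain ⟨B, hB, rfl⟩ := Finset.mem_image.1 hP
      obtain ⟨hBU, hYB⟩ := Finset.mem_filter.1 hB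
      refine ⟨fun a ha => ?_, ?_⟩
      · exact Finset.mem_compl.2 fun h => (Finset.mem_sdiff.1 ha).2 (hXY h)
      · rw [Finset.card_sdiff_of_subset hYB, hU B hBU]
        omega
  have hcard := Finset.card_le_card hsub
  rw [Finset.card_union_of_disjoint hdisj, card_image_sdiff_of_subset,
    card_image_sdiff_of_subset, Finset.card_powersetCard, Nat.choose_one_right,
    Finset.card_compl, Fintype.card_fin, hXc] at hcard
  omega
end

section
/- Let $n$ and $k$ be positive integers with $1 \le k \le n-1$. Let $\mathcal{S} \subseteq \binom{[n]}{k-1}$, $\mathcal{T} \subseteq \binom{[n]}{k}$, $\mathcal{U} \subseteq \binom{[n]}{k+1}$, and suppose $\mathcal{F} = \mathcal{S} \cup \mathcal{T} \cup \mathcal{U}$ is $Q_2$-free. Then for any $Y \in \mathcal{T}$ and $Z \in \mathcal{U}$ with $Y \subseteq Z$, we have $g(Z) + \breve{f}(Y) \le k + 1$, where $g(Z) = |\{T \in \mathcal{T} : T \subseteq Z\}|$ and $\breve{f}(Y) = |\{S \in \mathcal{S} : S \subseteq Y\}|$. -/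
theorem g_plus_f_breve_le (n k : ℕ) (hk1 : 1 ≤ k) (hkn : k ≤ n - 1)
    (S T U : Finset (Finset (Fin n)))
    (hS : ∀ A ∈ S, A.card = k - 1)
    (hT : ∀ A ∈ T, A.card = k)
    (hU : ∀ A ∈ U, A.card = k + 1)
    (hfree : Q2Free (S ∪ T ∪ U)) :
    ∀ Y ∈ T, ∀ Z ∈ U, Y ⊆ Z →
      (T.filter (fun T' => T' ⊆ Z)).card +
        (S.filter (fun S' => S' ⊆ Y)).card ≤ k + 1 := by
  intro Y hY Z hZ hYZ
  have hYc := hT Y hY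
  have hZc := hU Z hZ
  have hdiff : (Z \ Y).card = 1 := by
    rw [Finset.card_sdiff_of_subset hYZ]; omega
  have hcard : ∀ A ∈ S, A ⊆ Y → (A ∪ (Z \ Y)).card = k := fun A hA hAY => by
    rw [Finset.card_union_of_disjoint (Finset.disjoint_sdiff.mono_left hAY), hS A hA, hdiff]
    omega
  have hinj : Set.InjOn (fun A => A ∪ (Z \ Y)) (S.filter (fun A => A ⊆ Y) : Set _) := by
    have hinter : ∀ A ⊆ Y, (A ∪ (Z \ Y)) ∩ Y = A := fun A hA => by
      rw [Finset.union_inter_distrib_right, Finset.inter_eq_left.mpr hA,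
        Finset.sdiff_inter_self, Finset.union_empty]
    intro A hA B hB hAB
    simp only [Finset.coe_filter, Set.mem_ofPred_eq] at hA hB
    rw [← hinter A hA.2, ← hinter B hB.2]
    exact congrArg (· ∩ Y) hAB
  have hdisj : Disjoint (T.filter (fun A => A ⊆ Z))
      ((S.filter (fun A => A ⊆ Y)).image (fun A => A ∪ (Z \ Y))) := by
    rw [Finset.disjoint_right]
    intro B hB hBT
    obtain ⟨A, hA, rfl⟩ := Finset.mem_image.mp hB
    obtain ⟨hA, hAY⟩ := Finset.mem_filter.mp hA
    obtain ⟨hBT, hBZ⟩ := Finset.mem_filter.mp hBT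
    have hAc := hS A hA
    have hBc := hcard A hA hAY
    have hne : ∀ {P Q : Finset (Fin n)}, P.card ≠ Q.card → P ≠ Q :=
      fun h e => h (congrArg Finset.card e)
    have hYB : Y ≠ A ∪ (Z \ Y) := by
      intro h
      have hsub : Z \ Y ⊆ Y := Finset.subset_union_right.trans h.symm.subset
      have hempty := Finset.disjoint_self_iff_empty _ |>.mp
        (Finset.disjoint_sdiff.mono_left hsub)
      simp [hempty] at hdiff
    exact hfree ⟨A, Y, A ∪ (Z \ Y), Z, by simp [hA], by simp [hY],
      Finset.mem_union_left _ (Finset.mem_union_right _ hBT), by simp [hZ],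
      hne (by omega), hne (by omega), hne (by omega), hYB, hne (by omega), hne (by omega),
      hAY, hYZ, Finset.subset_union_left, hBZ⟩
  rw [← Finset.card_image_of_injOn hinj, ← Finset.card_union_of_disjoint hdisj]
  have hsub : T.filter (fun A => A ⊆ Z) ∪
      (S.filter (fun A => A ⊆ Y)).image (fun A => A ∪ (Z \ Y)) ⊆ Z.powersetCard k := by
    refine Finset.union_subset (fun A hA => ?_) (Finset.image_subset_iff.mpr fun A hA => ?_)
    · obtain ⟨hA, hAZ⟩ := Finset.mem_filter.mp hA
      exact Finset.mem_powersetCard.mpr ⟨hAZ, hT A hA⟩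
    · obtain ⟨hA, hAY⟩ := Finset.mem_filter.mp hA
      exact Finset.mem_powersetCard.mpr
        ⟨Finset.union_subset (hAY.trans hYZ) Finset.sdiff_subset, hcard A hA hAY⟩
  simpa [Finset.card_powersetCard, hZc] using Finset.card_le_card hsub
end

section
/- Let $n$ and $k$ be positive integers with $1 \le k \le n-1$. Let $\mathcal{S} \subseteq \binom{[n]}{k-1}$, $\mathcal{T} \subseteq \binom{[n]}{k}$, $\mathcal{U} \subseteq \binom{[n]}{k+1}$, and suppose $\mathcal{F} = \mathcal{S} \cup \mathcal{T} \cup \mathcal{U}$ is $Q_2$-free. Then $|\mathcal{S}| \ge \sum_{Y \in \mathcal{T}} \dfrac{\breve{f}(Y)}{(n-k+1) - \breve{g}(Y)}$ (as a sum of real numbers; note each denominator is at least $1$ since $\breve{g}(Y) \le n-k$), where $\breve{f}(Y) = |\{S \in \mathcal{S} : S \subseteq Y\}|$ and $\breve{g}(Y) = |\{U \in \mathcal{U} : Y \subseteq U\}|$. -/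
/-- A family of sets of size `s.card + 1` has at most as many members containing `s` as there are
elements extending `s` to a member of the family. -/
lemma card_filter_superset_le_s4 {α : Type*} [Fintype α] [DecidableEq α] (s : Finset α)
    (F : Finset (Finset α)) (hF : ∀ t ∈ F, t.card = s.card + 1) :
    (F.filter (fun t => s ⊆ t)).card ≤
      (Finset.univ.filter (fun x => x ∉ s ∧ insert x s ∈ F)).card := by
  refine (Finset.card_le_card (fun t ht => ?_)).trans
    (Finset.card_image_le (f := fun x => insert x s))
  obtain ⟨htF, hst⟩ := Finset.mem_filter.1 ht
  obtain ⟨x, hx, rfl⟩ := Finset.exists_eq_insert_iff.2 ⟨hst, (hF t htF).symm⟩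
  exact Finset.mem_image_of_mem _ (by simp [hx, htF])

/-- In a `Q₂`-free family on three consecutive levels, the members of the middle level above `A`
and the members of the top level above some `Y ⊇ A` use disjoint sets of new elements. -/
lemma Q2Free.card_add_card_le {α : Type*} [Fintype α] [DecidableEq α]
    {S T U : Finset (Finset α)} (hfree : Q2Free (S ∪ T ∪ U)) {A Y : Finset α}
    (hA : A ∈ S) (hY : Y ∈ T) (hAY : A ⊆ Y)
    (hT : ∀ t ∈ T, t.card = A.card + 1) (hU : ∀ u ∈ U, u.card = A.card + 2) :
    (T.filter (fun t => A ⊆ t)).card + (U.filter (fun u => Y ⊆ u)).card + A.card ≤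
      Fintype.card α := by
  have hYc := hT Y hY
  have h₁ := card_filter_superset_le_s4 A T hT
  have h₂ := card_filter_superset_le_s4 Y U (fun u hu => by rw [hU u hu, hYc])
  set P := Finset.univ.filter (fun x => x ∉ A ∧ insert x A ∈ T) with hP
  set Q := Finset.univ.filter (fun x => x ∉ Y ∧ insert x Y ∈ U) with hQ
  have hdisj : Disjoint P Q := by
    refine Finset.disjoint_left.2 fun x hxP hxQ => hfree ?_
    obtain ⟨hxA, hxT⟩ := (Finset.mem_filter.1 hxP).2
    obtain ⟨hxY, hxU⟩ := (Finset.mem_filter.1 hxQ).2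
    have hc₁ := hT _ hxT
    have hc₂ := hU _ hxU
    refine ⟨A, Y, insert x A, insert x Y, by simp [hA], by simp [hY], by simp [hxT],
      by simp [hxU], ?_, ?_, ?_, ?_, ?_, ?_, hAY, Finset.subset_insert _ _,
      Finset.subset_insert _ _, Finset.insert_subset_insert _ hAY⟩
    · intro h; rw [← h] at hYc; omega
    · intro h; rw [← h] at hc₁; omega
    · intro h; rw [← h] at hc₂; omega
    · intro h; exact hxY (h ▸ Finset.mem_insert_self x A)
    · intro h; exact hxY (h ▸ Finset.mem_insert_self x Y)
    · intro h; rw [← h] at hc₂; omega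
  have hsub : P ∪ Q ⊆ Aᶜ := by
    intro x hx
    rw [Finset.mem_compl]
    rcases Finset.mem_union.1 hx with hx | hx
    · exact (Finset.mem_filter.1 hx).2.1
    · exact fun h => (Finset.mem_filter.1 hx).2.1 (hAY h)
  have h₃ := Finset.card_le_card hsub
  rw [Finset.card_union_of_disjoint hdisj] at h₃
  have h₄ := Finset.card_add_card_compl A
  omega

theorem S_card_lower_bound (n k : ℕ) (hk1 : 1 ≤ k) (hkn : k ≤ n - 1)
    (S T U : Finset (Finset (Fin n)))
    (hS : ∀ A ∈ S, A.card = k - 1)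
    (hT : ∀ A ∈ T, A.card = k)
    (hU : ∀ A ∈ U, A.card = k + 1)
    (hfree : Q2Free (S ∪ T ∪ U)) :
    (S.card : ℝ) ≥
      ∑ Y ∈ T, ((S.filter (fun S' => S' ⊆ Y)).card : ℝ) /
        ((n : ℝ) - (k : ℝ) + 1 - ((U.filter (fun U' => Y ⊆ U')).card : ℝ)) := by
  have hlocal : ∀ A ∈ S, ∑ Y ∈ T.filter (fun Y => A ⊆ Y),
      1 / ((n : ℝ) - (k : ℝ) + 1 - ((U.filter (fun U' => Y ⊆ U')).card : ℝ)) ≤ 1 := by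
    intro A hA
    have hAc := hS A hA
    set m := (T.filter (fun Y => A ⊆ Y)).card with hm
    have hterm : ∀ Y ∈ T.filter (fun Y => A ⊆ Y),
        1 / ((n : ℝ) - (k : ℝ) + 1 - ((U.filter (fun U' => Y ⊆ U')).card : ℝ)) ≤
          1 / (m : ℝ) := by
      intro Y hY
      have hm0 : 0 < m := Finset.card_pos.2 ⟨Y, hY⟩
      obtain ⟨hYT, hAY⟩ := Finset.mem_filter.1 hY
      have h := hfree.card_add_card_le hA hYT hAY
        (fun t ht => by rw [hT t ht]; omega) (fun u hu => by rw [hU u hu]; omega)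
      rw [← hm, Fintype.card_fin] at h
      have h' : m + (U.filter (fun U' => Y ⊆ U')).card + k ≤ n + 1 := by omega
      have h'' : (m : ℝ) + ((U.filter (fun U' => Y ⊆ U')).card : ℝ) + k ≤ n + 1 := by
        exact_mod_cast h'
      exact one_div_le_one_div_of_le (by exact_mod_cast hm0) (by linarith)
    refine (Finset.sum_le_card_nsmul _ _ _ hterm).trans ?_
    rw [nsmul_eq_mul, ← hm, mul_one_div]
    exact div_self_le_one _
  calc ∑ Y ∈ T, ((S.filter (fun S' => S' ⊆ Y)).card : ℝ) /
        ((n : ℝ) - (k : ℝ) + 1 - ((U.filter (fun U' => Y ⊆ U')).card : ℝ))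
      = ∑ Y ∈ T, ∑ _A ∈ S.filter (fun S' => S' ⊆ Y),
          1 / ((n : ℝ) - (k : ℝ) + 1 - ((U.filter (fun U' => Y ⊆ U')).card : ℝ)) := by
        simp only [Finset.sum_const, nsmul_eq_mul, mul_one_div]
    _ = ∑ A ∈ S, ∑ Y ∈ T.filter (fun Y => A ⊆ Y),
          1 / ((n : ℝ) - (k : ℝ) + 1 - ((U.filter (fun U' => Y ⊆ U')).card : ℝ)) :=
        Finset.sum_comm' (by simp only [Finset.mem_filter]; tauto)
    _ ≤ ∑ _A ∈ S, (1 : ℝ) := Finset.sum_le_sum hlocal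
    _ = S.card := by simp
end

section
/- Let $n$ and $k$ be positive integers with $1 \le k \le n-1$. Let $\mathcal{S} \subseteq \binom{[n]}{k-1}$, $\mathcal{T} \subseteq \binom{[n]}{k}$, $\mathcal{U} \subseteq \binom{[n]}{k+1}$, and suppose $\mathcal{F} = \mathcal{S} \cup \mathcal{T} \cup \mathcal{U}$ is $Q_2$-free. Then $|\mathcal{U}| \ge \sum_{Y \in \mathcal{T}} \dfrac{\breve{g}(Y)}{(k+1) - \breve{f}(Y)}$ (as a sum of real numbers; note each denominator is at least $1$ since $\breve{f}(Y) \le k$), where $\breve{f}(Y) = |\{S \in \mathcal{S} : S \subseteq Y\}|$ and $\breve{g}(Y) = |\{U \in \mathcal{U} : Y \subseteq U\}|$. -/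
/-- In a `Q₂`-free family, if `Y` lies in the middle level `T` and `D` above it, then the number of
members of `S` below `Y` plus the number of members of `T` below `D` is at most `k + 1`. -/
lemma Q2Free.card_filter_add_card_filter_le {α : Type*} [DecidableEq α] {k : ℕ} (hk : 1 ≤ k)
    {S T U : Finset (Finset α)}
    (hS : ∀ A ∈ S, A.card = k - 1) (hT : ∀ A ∈ T, A.card = k) (hU : ∀ A ∈ U, A.card = k + 1)
    (hfree : Q2Free (S ∪ T ∪ U)) {Y D : Finset α} (hY : Y ∈ T) (hD : D ∈ U) (hYD : Y ⊆ D) :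
    (S.filter (fun A => A ⊆ Y)).card + (T.filter (fun B => B ⊆ D)).card ≤ k + 1 := by
  have hYc := hT Y hY
  have hDc := hU D hD
  have hsd : (D \ Y).card = 1 := by
    rw [Finset.card_sdiff_of_subset hYD]
    omega
  have hinj : Set.InjOn (fun A => A ∪ D \ Y) (S.filter (fun A => A ⊆ Y) : Set (Finset α)) := by
    intro A hA B hB hAB
    have hAY : A ⊆ Y := (Finset.mem_filter.1 hA).2
    have hBY : B ⊆ Y := (Finset.mem_filter.1 hB).2
    ext x
    have hx := Finset.ext_iff.1 hAB x
    simp only [Finset.mem_union, Finset.mem_sdiff] at hx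
    have := @hAY x
    have := @hBY x
    tauto
  have hcard : ∀ A ∈ S, A ⊆ Y → (A ∪ D \ Y).card = k := by
    intro A hA hAY
    rw [Finset.card_union_of_disjoint (Finset.disjoint_sdiff.mono_left hAY), hS A hA, hsd]
    omega
  have hdisj : Disjoint ((S.filter (fun A => A ⊆ Y)).image (fun A => A ∪ D \ Y))
      (T.filter (fun B => B ⊆ D)) := by
    rw [Finset.disjoint_left]
    intro C hC hCT
    obtain ⟨A, hA, rfl⟩ := Finset.mem_image.1 hC
    obtain ⟨hAS, hAY⟩ := Finset.mem_filter.1 hA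
    obtain ⟨hCT, hCD⟩ := Finset.mem_filter.1 hCT
    have hAc := hS A hAS
    have hCc := hcard A hAS hAY
    refine hfree ⟨A, Y, A ∪ D \ Y, D, by simp [hAS], by simp [hY], by simp [hCT], by simp [hD],
      ?_, ?_, ?_, ?_, ?_, ?_, hAY, hYD, Finset.subset_union_left, hCD⟩
    · rintro rfl; omega
    · intro h; rw [← h] at hCc; omega
    · rintro rfl; omega
    · intro h
      obtain ⟨x, hx⟩ := Finset.card_pos.1 (by omega : 0 < (D \ Y).card)
      exact (Finset.mem_sdiff.1 hx).2 (h ▸ Finset.mem_union_right A hx)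
    · rintro rfl; omega
    · intro h; rw [h] at hCc; omega
  rw [← Finset.card_image_of_injOn hinj, ← Finset.card_union_of_disjoint hdisj]
  calc _ ≤ (D.powersetCard k).card := by
        refine Finset.card_le_card fun C hC => Finset.mem_powersetCard.2 ?_
        rcases Finset.mem_union.1 hC with hC | hC
        · obtain ⟨A, hA, rfl⟩ := Finset.mem_image.1 hC
          obtain ⟨hAS, hAY⟩ := Finset.mem_filter.1 hA
          exact ⟨Finset.union_subset (hAY.trans hYD) Finset.sdiff_subset, hcard A hAS hAY⟩
        · obtain ⟨hCT, hCD⟩ := Finset.mem_filter.1 hC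
          exact ⟨hCD, hT C hCT⟩
    _ = k + 1 := by rw [Finset.card_powersetCard, hDc, Nat.choose_succ_self_right]

theorem U_card_lower_bound (n k : ℕ) (hk1 : 1 ≤ k) (hkn : k ≤ n - 1)
    (S T U : Finset (Finset (Fin n)))
    (hS : ∀ A ∈ S, A.card = k - 1)
    (hT : ∀ A ∈ T, A.card = k)
    (hU : ∀ A ∈ U, A.card = k + 1)
    (hfree : Q2Free (S ∪ T ∪ U)) :
    (U.card : ℝ) ≥
      ∑ Y ∈ T, ((U.filter (fun U' => Y ⊆ U')).card : ℝ) /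
        ((k : ℝ) + 1 - ((S.filter (fun S' => S' ⊆ Y)).card : ℝ)) := by
  set w : Finset (Fin n) → ℝ :=
    fun Y => 1 / ((k : ℝ) + 1 - ((S.filter (fun S' => S' ⊆ Y)).card : ℝ)) with hw
  have hswap : ∑ Y ∈ T, ((U.filter (fun U' => Y ⊆ U')).card : ℝ) /
        ((k : ℝ) + 1 - ((S.filter (fun S' => S' ⊆ Y)).card : ℝ)) =
      ∑ D ∈ U, ∑ Y ∈ T.filter (fun Y => Y ⊆ D), w Y := by
    simp only [Finset.sum_filter]
    rw [Finset.sum_comm]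
    refine Finset.sum_congr rfl fun Y _ => ?_
    rw [← Finset.sum_filter, Finset.sum_const, nsmul_eq_mul, hw, mul_one_div]
  rw [ge_iff_le, hswap, Finset.card_eq_sum_ones, Nat.cast_sum]
  refine Finset.sum_le_sum fun D hD => ?_
  rw [Nat.cast_one]
  set m := (T.filter (fun Y => Y ⊆ D)).card with hm
  calc ∑ Y ∈ T.filter (fun Y => Y ⊆ D), w Y
      ≤ ∑ _Y ∈ T.filter (fun Y => Y ⊆ D), 1 / (m : ℝ) := by
        refine Finset.sum_le_sum fun Y hY => ?_
        have hpos : (0 : ℝ) < m := by exact_mod_cast Finset.card_pos.2 ⟨Y, hY⟩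
        obtain ⟨hYT, hYD⟩ := Finset.mem_filter.1 hY
        have hle : (((S.filter (fun A => A ⊆ Y)).card + m : ℕ) : ℝ) ≤ ((k + 1 : ℕ) : ℝ) :=
          Nat.cast_le.2 (hfree.card_filter_add_card_filter_le hk1 hS hT hU hYT hD hYD)
        push_cast at hle
        exact one_div_le_one_div_of_le hpos (by linarith)
    _ = (m : ℝ) / m := by rw [Finset.sum_const, nsmul_eq_mul, mul_one_div]
    _ ≤ 1 := div_self_le_one _
end
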